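/- arXiv:1610.01722 — 5 statements merged into one kernel-verified Lean document; each statement's English description precedes it below -/
import Mathlib

section
/- Let L be a finite bounded distributive lattice and R ⊆ L × L a binary relation. Then the congruence closure of R coincides with its logical closure: for all p, q ∈ L, p ≡_R q if and only if h p = h q for every bounded lattice homomorphism h : L → Bool that is consistent with R. -/
/-- The congruence closure of a relation `R` on a lattice: the smallest equivalence
relation containing `R` that is compatible with `⊓` and `⊔`. -/
inductive CongClosure {L : Type*} [Lattice L] (R : L → L → Prop) : L → L → Prop
  | of {p q : L} : R p q → CongClosure R p q
  | refl (p : L) : CongClosure R p p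
  | symm {p q : L} : CongClosure R p q → CongClosure R q p
  | trans {p q r : L} : CongClosure R p q → CongClosure R q r → CongClosure R p r
  | inf {p₁ q₁ p₂ q₂ : L} : CongClosure R p₁ q₁ → CongClosure R p₂ q₂ →
      CongClosure R (p₁ ⊓ p₂) (q₁ ⊓ q₂)
  | sup {p₁ q₁ p₂ q₂ : L} : CongClosure R p₁ q₁ → CongClosure R p₂ q₂ →
      CongClosure R (p₁ ⊔ p₂) (q₁ ⊔ q₂)

namespace CongClosure

theorem map_eq {L M : Type*} [Lattice L] [Lattice M] {R : L → L → Prop} {F : Type*}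
    [FunLike F L M] [LatticeHomClass F L M] (f : F) (hR : ∀ a b, R a b → f a = f b)
    {p q : L} (h : CongClosure R p q) : f p = f q := by
  induction h with
  | of h => exact hR _ _ h
  | refl => rfl
  | symm _ ih => exact ih.symm
  | trans _ _ ih₁ ih₂ => exact ih₁.trans ih₂
  | inf _ _ ih₁ ih₂ => rw [map_inf, map_inf, ih₁, ih₂]
  | sup _ _ ih₁ ih₂ => rw [map_sup, map_sup, ih₁, ih₂]

/-- The congruence closure of `R` as a setoid. -/
def setoid {L : Type*} [Lattice L] (R : L → L → Prop) : Setoid L where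
  r := CongClosure R
  iseqv := ⟨refl, symm, trans⟩

/-- The quotient of a lattice by the congruence generated by `R`. -/
def QuotientLattice {L : Type*} [Lattice L] (R : L → L → Prop) : Type _ :=
  Quotient (setoid R)

instance {L : Type*} [Lattice L] (R : L → L → Prop) : Max (QuotientLattice R) :=
  ⟨Quotient.map₂ (sa := setoid R) (sb := setoid R) (sc := setoid R) (· ⊔ ·)
    fun _ _ h₁ _ _ h₂ => sup h₁ h₂⟩

instance {L : Type*} [Lattice L] (R : L → L → Prop) : Min (QuotientLattice R) :=
  ⟨Quotient.map₂ (sa := setoid R) (sb := setoid R) (sc := setoid R) (· ⊓ ·)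
    fun _ _ h₁ _ _ h₂ => inf h₁ h₂⟩

instance {L : Type*} [Lattice L] (R : L → L → Prop) : Lattice (QuotientLattice R) :=
  Lattice.mk'
    (by rintro ⟨a⟩ ⟨b⟩; exact congrArg (Quotient.mk (setoid R)) (sup_comm a b))
    (by rintro ⟨a⟩ ⟨b⟩ ⟨c⟩; exact congrArg (Quotient.mk (setoid R)) (sup_assoc a b c))
    (by rintro ⟨a⟩ ⟨b⟩; exact congrArg (Quotient.mk (setoid R)) (inf_comm a b))
    (by rintro ⟨a⟩ ⟨b⟩ ⟨c⟩; exact congrArg (Quotient.mk (setoid R)) (inf_assoc a b c))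
    (by rintro ⟨a⟩ ⟨b⟩; exact congrArg (Quotient.mk (setoid R)) (sup_inf_self (a := a) (b := b)))
    (by rintro ⟨a⟩ ⟨b⟩; exact congrArg (Quotient.mk (setoid R)) (inf_sup_self (a := a) (b := b)))

instance {L : Type*} [DistribLattice L] (R : L → L → Prop) :
    DistribLattice (QuotientLattice R) :=
  DistribLattice.ofInfSupLe (by
    rintro ⟨a⟩ ⟨b⟩ ⟨c⟩
    exact le_of_eq (α := QuotientLattice R)
      (congrArg (Quotient.mk (setoid R)) (inf_sup_left a b c)))

instance {L : Type*} [Lattice L] [BoundedOrder L] (R : L → L → Prop) :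
    BoundedOrder (QuotientLattice R) where
  top := Quotient.mk (setoid R) ⊤
  bot := Quotient.mk (setoid R) ⊥
  le_top := by
    rintro ⟨a⟩
    exact (sup_eq_right (α := QuotientLattice R)).mp
      (congrArg (Quotient.mk (setoid R)) (sup_top_eq a))
  bot_le := by
    rintro ⟨a⟩
    exact (sup_eq_right (α := QuotientLattice R)).mp
      (congrArg (Quotient.mk (setoid R)) (bot_sup_eq a))

/-- The quotient map as a bounded lattice homomorphism. -/
def mkHom {L : Type*} [Lattice L] [BoundedOrder L] (R : L → L → Prop) :
    BoundedLatticeHom L (QuotientLattice R) where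
  toFun := Quotient.mk (setoid R)
  map_sup' _ _ := rfl
  map_inf' _ _ := rfl
  map_top' := rfl
  map_bot' := rfl

end CongClosure

open scoped Classical in
/-- The characteristic function of the complement of a prime ideal. -/
noncomputable def Order.Ideal.IsPrime.complHom {D : Type*} [Lattice D] [BoundedOrder D]
    {J : Order.Ideal D} (hJ : J.IsPrime) : BoundedLatticeHom D Bool where
  toFun a := decide (a ∉ J)
  map_sup' a b := by
    by_cases ha : a ∈ J <;> by_cases hb : b ∈ J <;> simp [Order.Ideal.sup_mem_iff, ha, hb]
  map_inf' a b := by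
    have h : a ⊓ b ∈ J ↔ a ∈ J ∨ b ∈ J :=
      ⟨hJ.mem_or_mem, fun h => h.elim (J.lower inf_le_left) (J.lower inf_le_right)⟩
    by_cases ha : a ∈ J <;> by_cases hb : b ∈ J <;> simp [h, ha, hb]
  map_top' := by simpa using hJ.toIsProper.top_notMem
  map_bot' := by simp

/-- Bounded lattice homomorphisms to `Bool` separate the points of a bounded distributive
lattice. -/
theorem exists_boundedLatticeHom_bool_ne {D : Type*} [DistribLattice D] [BoundedOrder D]
    {x y : D} (hxy : x ≠ y) : ∃ f : BoundedLatticeHom D Bool, f x ≠ f y := by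
  wlog h : ¬ x ≤ y generalizing x y
  · obtain ⟨f, hf⟩ := this hxy.symm fun hyx => hxy (le_antisymm (not_not.mp h) hyx)
    exact ⟨f, hf.symm⟩
  obtain ⟨J, hJ, hyJ, hxJ⟩ := DistribLattice.prime_ideal_of_disjoint_filter_ideal
    (F := Order.PFilter.principal x) (I := Order.Ideal.principal y)
    (Set.disjoint_left.mpr fun _ hz hz' => h (le_trans hz hz'))
  have hx : x ∉ J := fun hx => Set.disjoint_left.mp hxJ (le_refl x) hx
  have hy : y ∈ J := hyJ (le_refl y)
  exact ⟨hJ.complHom, by simp [Order.Ideal.IsPrime.complHom, hx, hy]⟩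

/-- For a finite bounded distributive lattice, the congruence closure of `R` coincides
with its logical closure: `p ≡_R q` iff every bounded lattice homomorphism `h : L → Bool`
that is consistent with `R` satisfies `h p = h q`. -/
theorem stmt_3 (L : Type*) [DistribLattice L] [BoundedOrder L] [Fintype L]
    (R : L → L → Prop) (p q : L) :
    CongClosure R p q ↔
      ∀ h : BoundedLatticeHom L Bool, (∀ a b, R a b → h a = h b) → h p = h q := by
  refine ⟨fun hpq h hR => hpq.map_eq h hR, fun H => ?_⟩
  apply Quotient.exact (s := CongClosure.setoid R)
  by_contra hne
  obtain ⟨f, hf⟩ := exists_boundedLatticeHom_bool_ne (D := CongClosure.QuotientLattice R) hne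
  exact hf (H (f.comp (CongClosure.mkHom R))
    fun a b hab => congrArg f (Quotient.sound (CongClosure.of hab)))
end

section
/- Let L be a finite bounded distributive lattice, α a type of characters, F : L → Bool a bounded lattice homomorphism, and for each a : α let Δ_a : L → L be a bounded lattice homomorphism. Let R ⊆ L × L. Then R is a bisimulation up to congruence (i.e., for all (p,q) ∈ R, F p = F q and Δ_a p ≡_R Δ_a q for every a : α) if and only if ≡_R is a bisimulation (i.e., for all p, q with p ≡_R q, F p = F q and Δ_a p ≡_R Δ_a q for every a : α). -/
/-- `R` is a bisimulation up to congruence if and only if the congruence closure `≡_R`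
is a bisimulation. -/
theorem stmt_6 (L α : Type*) [DistribLattice L] [BoundedOrder L] [Fintype L]
    (F : BoundedLatticeHom L Bool) (Δ : α → BoundedLatticeHom L L)
    (R : L → L → Prop) :
    (∀ p q, R p q → F p = F q ∧ ∀ a : α, CongClosure R (Δ a p) (Δ a q)) ↔
    (∀ p q, CongClosure R p q →
      F p = F q ∧ ∀ a : α, CongClosure R (Δ a p) (Δ a q)) := by
  refine ⟨fun h p q hpq => ?_, fun h p q hpq => h p q (.of hpq)⟩
  induction hpq with
  | of hR => exact h _ _ hR
  | refl p => exact ⟨rfl, fun _ => .refl _⟩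
  | symm _ ih => exact ⟨ih.1.symm, fun a => (ih.2 a).symm⟩
  | trans _ _ ih₁ ih₂ => exact ⟨ih₁.1.trans ih₂.1, fun a => (ih₁.2 a).trans (ih₂.2 a)⟩
  | inf _ _ ih₁ ih₂ =>
    simp only [map_inf]
    exact ⟨congrArg₂ _ ih₁.1 ih₂.1, fun a => (ih₁.2 a).inf (ih₂.2 a)⟩
  | sup _ _ ih₁ ih₂ =>
    simp only [map_sup]
    exact ⟨congrArg₂ _ ih₁.1 ih₂.1, fun a => (ih₁.2 a).sup (ih₂.2 a)⟩
end

section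
/- Let L be a finite bounded distributive lattice, α a type of characters, F : L → Bool a bounded lattice homomorphism, and for each a : α let Δ_a : L → L be a bounded lattice homomorphism. For w = a₁⋯aₙ : List α write Δ_w = Δ_{aₙ} ∘ ⋯ ∘ Δ_{a₁} and define the language L(c) = { w : List α | F (Δ_w c) = true }. If R ⊆ L × L is a bisimulation up to congruence (for all (p,q) ∈ R, F p = F q and Δ_a p ≡_R Δ_a q for every a : α), then for every (p,q) ∈ R one has L(p) = L(q). -/
namespace CongClosure

variable {L M : Type*} [Lattice L] [Lattice M] {R : L → L → Prop}

/-- A lattice homomorphism that maps `R` into the congruence closure of `S` maps the congruence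
closure of `R` into that of `S`. -/
theorem map {S : M → M → Prop} (f : LatticeHom L M)
    (hf : ∀ p q, R p q → CongClosure S (f p) (f q)) {p q : L} (h : CongClosure R p q) :
    CongClosure S (f p) (f q) := by
  induction h with
  | of h => exact hf _ _ h
  | refl p => exact .refl _
  | symm _ ih => exact ih.symm
  | trans _ _ ih₁ ih₂ => exact ih₁.trans ih₂
  | inf _ _ ih₁ ih₂ => simpa only [map_inf] using ih₁.inf ih₂
  | sup _ _ ih₁ ih₂ => simpa only [map_sup] using ih₁.sup ih₂

/-- A lattice homomorphism that identifies `R`-related elements identifies elements related by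
the congruence closure of `R`. -/
theorem map_eq_s7 (f : LatticeHom L M) (hf : ∀ p q, R p q → f p = f q) {p q : L}
    (h : CongClosure R p q) : f p = f q := by
  induction h with
  | of h => exact hf _ _ h
  | refl p => rfl
  | symm _ ih => exact ih.symm
  | trans _ _ ih₁ ih₂ => exact ih₁.trans ih₂
  | inf _ _ ih₁ ih₂ => rw [map_inf, map_inf, ih₁, ih₂]
  | sup _ _ ih₁ ih₂ => rw [map_sup, map_sup, ih₁, ih₂]

end CongClosure

/-- Soundness of bisimulation up to congruence: if `R` is a bisimulation up to
congruence, then related elements recognize the same language. -/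
theorem stmt_7 {L α : Type*} [DistribLattice L] [BoundedOrder L] [Fintype L]
    (F : BoundedLatticeHom L Bool) (Δ : α → BoundedLatticeHom L L)
    (R : L → L → Prop)
    (hbisim : ∀ p q, R p q → F p = F q ∧ ∀ a : α, CongClosure R (Δ a p) (Δ a q)) :
    ∀ p q, R p q →
      { w : List α | F (w.foldl (fun c a => Δ a c) p) = true } =
      { w : List α | F (w.foldl (fun c a => Δ a c) q) = true } := by
  have foldl_eq (w : List α) : ∀ p q, CongClosure R p q →
      F (w.foldl (fun c a => Δ a c) p) = F (w.foldl (fun c a => Δ a c) q) := by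
    induction w with
    | nil => exact fun p q h => h.map_eq_s7 F.toLatticeHom fun p q h => (hbisim p q h).1
    | cons a w ih =>
      exact fun p q h => ih _ _ (h.map (Δ a).toLatticeHom fun p q h => (hbisim p q h).2 a)
  intro p q h
  ext w
  rw [Set.mem_ofPred_eq, Set.mem_ofPred_eq, foldl_eq w p q (.of h)]
end

section
/- Let M = (Q, p₀, F, Δ) and M' = (Q', p₀', F', Δ') be s-AFAs over the same alphabet type α. Define their union M ∪ M' as the s-AFA over states Q ⊕ Q' whose accepting set is the union of the images of F and F' under inl and inr, whose transition set is the union of the images of Δ and Δ' (guards unchanged, target formulas mapped by subst (var ∘ inl) resp. subst (var ∘ inr)), and whose initial formula is or (subst (var ∘ inl) p₀) (subst (var ∘ inr) p₀'). Then the language of M ∪ M' equals L(M) ∪ L(M'). -/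
/-- Positive Boolean formulas over a type `Q`. -/
inductive PBF (Q : Type u) : Type u where
  | tt : PBF Q
  | ff : PBF Q
  | var : Q → PBF Q
  | and : PBF Q → PBF Q → PBF Q
  | or : PBF Q → PBF Q → PBF Q

/-- Evaluation of a positive Boolean formula under a model `m : Q → Bool`. -/
def PBF.eval {Q : Type*} (m : Q → Bool) : PBF Q → Bool
  | .tt => true
  | .ff => false
  | .var q => m q
  | .and p q => p.eval m && q.eval m
  | .or p q => p.eval m || q.eval m

/-- Substitution: replace each variable `q` by `σ q`. -/
def PBF.subst {Q R : Type*} (σ : Q → PBF R) : PBF Q → PBF R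
  | .tt => .tt
  | .ff => .ff
  | .var q => σ q
  | .and p q => .and (p.subst σ) (q.subst σ)
  | .or p q => .or (p.subst σ) (q.subst σ)

/-- A symbolic alternating finite automaton over an alphabet type `α`. -/
structure SAFA (α : Type*) where
  /-- states -/
  Q : Type
  [fin : Fintype Q]
  /-- initial formula -/
  init : PBF Q
  /-- accepting states -/
  F : Set Q
  /-- transitions `(source, guard, target formula)` -/
  Δ : Finset (Q × Set α × PBF Q)

attribute [instance] SAFA.fin

/-- One-step transition function `Δ_a : Q → PBF Q`: the disjunction of all targets `q`
over transitions `(s, φ, q) ∈ Δ` with `a ∈ φ` (the empty disjunction is `ff`). -/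
noncomputable def SAFA.step {α : Type*} (M : SAFA α) (a : α) (s : M.Q) : PBF M.Q :=
  letI := Classical.propDecidable
  (M.Δ.toList.filter (fun t => decide (t.1 = s ∧ a ∈ t.2.1))).foldr
    (fun t acc => .or t.2.2 acc) .ff

/-- Transition function on words, extended to formulas by substitution:
`Δ_w = Δ_{aₙ} ∘ ⋯ ∘ Δ_{a₁}`. -/
noncomputable def SAFA.run {α : Type*} (M : SAFA α) (w : List α) (p : PBF M.Q) : PBF M.Q :=
  w.foldl (fun p a => p.subst (M.step a)) p

/-- `F̂ : PBF Q → Bool`: evaluation under the indicator function of the accepting set. -/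
noncomputable def SAFA.Fhat {α : Type*} (M : SAFA α) (p : PBF M.Q) : Bool :=
  letI := Classical.propDecidable
  p.eval (fun s => decide (s ∈ M.F))

/-- The language of a formula `p` in the s-AFA `M`. -/
noncomputable def SAFA.langOf {α : Type*} (M : SAFA α) (p : PBF M.Q) : Set (List α) :=
  { w : List α | M.Fhat (M.run w p) = true }

/-- The language of the s-AFA `M`. -/
noncomputable def SAFA.lang {α : Type*} (M : SAFA α) : Set (List α) :=
  M.langOf M.init

/-- The union of two s-AFAs: disjoint union of states and transitions, initial formula
the disjunction of the (injected) initial formulas. -/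
noncomputable def SAFA.union {α : Type*} (M M' : SAFA α) : SAFA α where
  Q := M.Q ⊕ M'.Q
  init := .or (M.init.subst (.var ∘ Sum.inl)) (M'.init.subst (.var ∘ Sum.inr))
  F := (Sum.inl '' M.F) ∪ (Sum.inr '' M'.F)
  Δ :=
    letI := Classical.decEq ((M.Q ⊕ M'.Q) × Set α × PBF (M.Q ⊕ M'.Q))
    (M.Δ.image (fun t => (Sum.inl t.1, t.2.1, t.2.2.subst (.var ∘ Sum.inl)))) ∪
    (M'.Δ.image (fun t => (Sum.inr t.1, t.2.1, t.2.2.subst (.var ∘ Sum.inr))))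

theorem PBF.eval_subst {Q R : Type*} (m : R → Bool) (σ : Q → PBF R) (p : PBF Q) :
    (p.subst σ).eval m = p.eval (fun q => (σ q).eval m) := by
  induction p <;> simp_all [PBF.eval, PBF.subst]

theorem PBF.eval_foldr_or {Q T : Type*} (m : Q → Bool) (f : T → PBF Q) (l : List T) :
    (l.foldr (fun t acc => PBF.or (f t) acc) .ff).eval m = true ↔
      ∃ t ∈ l, (f t).eval m = true := by
  induction l <;> simp_all [PBF.eval]

namespace SAFA

variable {α : Type*}

theorem eval_step (M : SAFA α) (m : M.Q → Bool) (a : α) (s : M.Q) :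
    (M.step a s).eval m = true ↔
      ∃ t ∈ M.Δ, (t.1 = s ∧ a ∈ t.2.1) ∧ t.2.2.eval m = true := by
  unfold step
  rw [PBF.eval_foldr_or m (fun t : M.Q × Set α × PBF M.Q => t.2.2)]
  simp only [List.mem_filter, Finset.mem_toList, decide_eq_true_eq, and_assoc]

theorem Fhat_run (M : SAFA α) (w : List α) (p : PBF M.Q) :
    M.Fhat (M.run w p) = p.eval (fun s => M.Fhat (M.run w (.var s))) := by
  induction w generalizing p with
  | nil => rfl
  | cons a w ih =>
    change M.Fhat (M.run w (p.subst (M.step a))) =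
      p.eval (fun s => M.Fhat (M.run w (M.step a s)))
    rw [ih, PBF.eval_subst]
    congr 1
    funext s
    exact (ih _).symm

theorem Fhat_run_cons_var (M : SAFA α) (a : α) (w : List α) (s : M.Q) :
    M.Fhat (M.run (a :: w) (.var s)) =
      (M.step a s).eval (fun r => M.Fhat (M.run w (.var r))) :=
  M.Fhat_run w (M.step a s)

/-- A map of states that preserves and reflects acceptance and outgoing transitions
preserves acceptance of words. -/
theorem Fhat_run_subst {M N : SAFA α} (f : M.Q → N.Q) (hF : ∀ s, f s ∈ N.F ↔ s ∈ M.F)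
    (hΔ : ∀ s φ q, (f s, φ, q) ∈ N.Δ ↔
      ∃ p, (s, φ, p) ∈ M.Δ ∧ p.subst (.var ∘ f) = q)
    (w : List α) (p : PBF M.Q) :
    N.Fhat (N.run w (p.subst (.var ∘ f))) = M.Fhat (M.run w p) := by
  rw [N.Fhat_run, M.Fhat_run, PBF.eval_subst]
  congr 1
  funext s
  change N.Fhat (N.run w (.var (f s))) = M.Fhat (M.run w (.var s))
  induction w generalizing s with
  | nil => simp [run, Fhat, PBF.eval, hF]
  | cons a w ih =>
    have eval_target (q : PBF M.Q) :
        (q.subst (.var ∘ f)).eval (fun r => N.Fhat (N.run w (.var r))) =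
          q.eval (fun r => M.Fhat (M.run w (.var r))) := by
      rw [PBF.eval_subst]
      congr 1
      funext r
      exact ih r
    rw [Fhat_run_cons_var, Fhat_run_cons_var, Bool.eq_iff_iff, eval_step, eval_step]
    constructor
    · rintro ⟨⟨_, φ, q⟩, ht, ⟨rfl, ha⟩, hq⟩
      obtain ⟨p, hp, rfl⟩ := (hΔ s φ q).1 ht
      exact ⟨(s, φ, p), hp, ⟨rfl, ha⟩, (eval_target p).symm.trans hq⟩
    · rintro ⟨⟨_, φ, p⟩, ht, ⟨rfl, ha⟩, hp⟩
      exact ⟨(f _, φ, _), (hΔ _ φ _).2 ⟨p, ht, rfl⟩, ⟨rfl, ha⟩, (eval_target p).trans hp⟩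

theorem mem_union_F (M M' : SAFA α) (s : M.Q ⊕ M'.Q) :
    s ∈ (M.union M').F ↔ (∃ r ∈ M.F, Sum.inl r = s) ∨ ∃ r ∈ M'.F, Sum.inr r = s :=
  Iff.rfl

theorem mem_union_Δ (M M' : SAFA α) (t : (M.Q ⊕ M'.Q) × Set α × PBF (M.Q ⊕ M'.Q)) :
    t ∈ (M.union M').Δ ↔
      (∃ u ∈ M.Δ, (Sum.inl u.1, u.2.1, u.2.2.subst (.var ∘ Sum.inl)) = t) ∨
        ∃ u ∈ M'.Δ, (Sum.inr u.1, u.2.1, u.2.2.subst (.var ∘ Sum.inr)) = t := by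
  let := Classical.decEq ((M.Q ⊕ M'.Q) × Set α × PBF (M.Q ⊕ M'.Q))
  exact Finset.mem_union.trans (or_congr Finset.mem_image Finset.mem_image)

theorem Fhat_run_union_inl (M M' : SAFA α) (w : List α) (p : PBF M.Q) :
    (M.union M').Fhat ((M.union M').run w (p.subst (.var ∘ Sum.inl))) =
      M.Fhat (M.run w p) :=
  Fhat_run_subst (N := M.union M') Sum.inl
    (fun s => (mem_union_F M M' (Sum.inl s)).trans (by simp))
    (fun s φ (q : PBF (M.Q ⊕ M'.Q)) => (mem_union_Δ M M' (Sum.inl s, φ, q)).trans (by simp; rfl))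
    w p

theorem Fhat_run_union_inr (M M' : SAFA α) (w : List α) (p : PBF M'.Q) :
    (M.union M').Fhat ((M.union M').run w (p.subst (.var ∘ Sum.inr))) =
      M'.Fhat (M'.run w p) :=
  Fhat_run_subst (N := M.union M') Sum.inr
    (fun s => (mem_union_F M M' (Sum.inr s)).trans (by simp))
    (fun s φ (q : PBF (M.Q ⊕ M'.Q)) => (mem_union_Δ M M' (Sum.inr s, φ, q)).trans (by simp; rfl))
    w p

end SAFA

/-- The union construction recognizes the union of the languages. -/
theorem stmt_9 {α : Type*} (M M' : SAFA α) :
    (M.union M').lang = M.lang ∪ M'.lang := by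
  ext w
  change (M.union M').Fhat ((M.union M').run w (M.union M').init) = true ↔
    M.Fhat (M.run w M.init) = true ∨ M'.Fhat (M'.run w M'.init) = true
  rw [← M.Fhat_run_union_inl M', ← M.Fhat_run_union_inr M', SAFA.Fhat_run,
    SAFA.Fhat_run _ _ (M.init.subst _), SAFA.Fhat_run _ _ (M'.init.subst _), ← Bool.or_eq_true]
  rfl
end

section
/- Let M = (Q, p₀, F, Δ) be an s-AFA over an alphabet type α, let p, q : PBF Q, and let S ⊆ Q contain every state occurring in p or in q. Let E be a binary relation on PBF Q, and let B ⊆ α be a representative set for the relation ≃_S, i.e., for every a : α there exists b ∈ B with Δ_a s = Δ_b s for all s ∈ S. If E (Δ_b p) (Δ_b q) holds for all b ∈ B, then E (Δ_a p) (Δ_a q) holds for all a : α. -/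
/-- The set of states occurring (as variables) in a positive Boolean formula. -/
def PBF.states {Q : Type*} : PBF Q → Set Q
  | .tt => ∅
  | .ff => ∅
  | .var q => {q}
  | .and p q => p.states ∪ q.states
  | .or p q => p.states ∪ q.states

/-- Substitutions that agree on the states of a formula give the same result on it. -/
theorem PBF.subst_congr {Q R : Type*} {σ τ : Q → PBF R} {p : PBF Q}
    (h : ∀ s ∈ p.states, σ s = τ s) : p.subst σ = p.subst τ := by
  induction p with
  | tt => rfl
  | ff => rfl
  | var q => exact h q rfl
  | and p q ihp ihq =>
    exact congrArg₂ PBF.and (ihp fun s hs => h s (Or.inl hs)) (ihq fun s hs => h s (Or.inr hs))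
  | or p q ihp ihq =>
    exact congrArg₂ PBF.or (ihp fun s hs => h s (Or.inl hs)) (ihq fun s hs => h s (Or.inr hs))

/-- Correctness of the representative-character enumeration: if `S` contains all states
of `p` and `q`, `B` is a set of representatives for `≃_S`, and `E (Δ_b p) (Δ_b q)` holds
for every representative `b ∈ B`, then `E (Δ_a p) (Δ_a q)` holds for every character
`a`. -/
theorem stmt_14 {α : Type*} (M : SAFA α) (p q : PBF M.Q) (S : Set M.Q)
    (hS : p.states ∪ q.states ⊆ S)
    (E : PBF M.Q → PBF M.Q → Prop) (B : Set α)
    (hB : ∀ a : α, ∃ b ∈ B, ∀ s ∈ S, M.step a s = M.step b s)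
    (hE : ∀ b ∈ B, E (p.subst (M.step b)) (q.subst (M.step b))) :
    ∀ a : α, E (p.subst (M.step a)) (q.subst (M.step a)) := by
  intro a
  obtain ⟨b, hb, hab⟩ := hB a
  rw [PBF.subst_congr fun s hs => hab s (hS (Or.inl hs)),
    PBF.subst_congr fun s hs => hab s (hS (Or.inr hs))]
  exact hE b hb
end
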